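/- Assume Δ > 0, η ≤ Δ²/(36·λ₁*³), and X₀ ∈ R. Define P_t = Λ_r − U_t U_tᵀ ∈ ℝ^{r×r}. Then for all t ≥ 0, σ₁(P_{t+1}) ≤ (100·λ₁*²/(η·Δ²))·(1 − ηΔ/4)^{t+1}. -/

import Mathlib

open Matrix

/-- The largest singular value of a real matrix. -/
noncomputable def sigmaMax {m n : ℕ} (M : Matrix (Fin m) (Fin n) ℝ) : ℝ :=
  sSup {c : ℝ | ∃ v : EuclideanSpace ℝ (Fin n), ‖v‖ = 1 ∧
    c = ‖(EuclideanSpace.equiv (Fin m) ℝ).symm (M.mulVec ((EuclideanSpace.equiv (Fin n) ℝ) v))‖}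

/-- The smallest singular value (the `n`-th largest, for a matrix with `n` columns). -/
noncomputable def sigmaMin {m n : ℕ} (M : Matrix (Fin m) (Fin n) ℝ) : ℝ :=
  sInf {c : ℝ | ∃ v : EuclideanSpace ℝ (Fin n), ‖v‖ = 1 ∧
    c = ‖(EuclideanSpace.equiv (Fin m) ℝ).symm (M.mulVec ((EuclideanSpace.equiv (Fin n) ℝ) v))‖}

/-- Frobenius norm of a real matrix. -/
noncomputable def frobNorm {m n : ℕ} (M : Matrix (Fin m) (Fin n) ℝ) : ℝ :=
  Real.sqrt (∑ i, ∑ j, (M i j) ^ 2)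

/-- Gradient descent iterates `X_{t+1} = X_t + η (Σ - X_t X_tᵀ) X_t`. -/
noncomputable def gdIter {d r : ℕ} (S : Matrix (Fin d) (Fin d) ℝ) (η : ℝ)
    (X0 : Matrix (Fin d) (Fin r) ℝ) : ℕ → Matrix (Fin d) (Fin r) ℝ
  | 0 => X0
  | t + 1 => gdIter S η X0 t +
      η • ((S - gdIter S η X0 t * (gdIter S η X0 t)ᵀ) * gdIter S η X0 t)

/-- The top `r × r` block `U` (first `r` rows) of `X ∈ ℝ^{d×r}`. -/
def topBlock {d r : ℕ} (h : r ≤ d) (X : Matrix (Fin d) (Fin r) ℝ) :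
    Matrix (Fin r) (Fin r) ℝ :=
  fun i j => X (Fin.castLE h i) j

/-- The bottom `(d-r) × r` block `J` (last `d-r` rows) of `X ∈ ℝ^{d×r}`. -/
def botBlock {d r : ℕ} (X : Matrix (Fin d) (Fin r) ℝ) :
    Matrix (Fin (d - r)) (Fin r) ℝ :=
  fun i j => X ⟨r + (i : ℕ), by have := i.isLt; omega⟩ j

/-- The region `R = {X : σ₁(X)² ≤ 2λ₁*, σ₁(J)² ≤ λ_r* − Δ/2, σ_r(U)² ≥ Δ/4}`. -/
def inR {d r : ℕ} (h : r ≤ d) (lam1 lamr Δ : ℝ) (X : Matrix (Fin d) (Fin r) ℝ) : Prop :=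
  sigmaMax X ^ 2 ≤ 2 * lam1 ∧ sigmaMax (botBlock X) ^ 2 ≤ lamr - Δ / 2 ∧
    Δ / 4 ≤ sigmaMin (topBlock h X) ^ 2

/-- The region `R₂ = {X : σ₁(X)² ≤ 2λ₁*, σ₁(J)² ≤ λ_r* − Δ/2}`. -/
def inR2 {d r : ℕ} (lam1 lamr Δ : ℝ) (X : Matrix (Fin d) (Fin r) ℝ) : Prop :=
  sigmaMax X ^ 2 ≤ 2 * lam1 ∧ sigmaMax (botBlock X) ^ 2 ≤ lamr - Δ / 2

section Op
open scoped InnerProductSpace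
set_option linter.unusedSectionVars false
variable {E F G : Type*} [NormedAddCommGroup E] [InnerProductSpace ℝ E] [CompleteSpace E]
  [NormedAddCommGroup F] [InnerProductSpace ℝ F] [CompleteSpace F]
  [NormedAddCommGroup G] [InnerProductSpace ℝ G] [CompleteSpace G]

/-- A symmetric operator `D` with `0 ≤ D ≤ M` satisfies `D² ≤ M D`. -/
theorem norm_sq_apply_le_of_psd {D : F →L[ℝ] F} (hD : ∀ x y, ⟪D x, y⟫_ℝ = ⟪x, D y⟫_ℝ) {M : ℝ}
    (hM : 0 < M) (h0 : ∀ x, 0 ≤ ⟪D x, x⟫_ℝ) (h1 : ∀ x, ⟪D x, x⟫_ℝ ≤ M * ‖x‖ ^ 2) (u : F) :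
    ‖D u‖ ^ 2 ≤ M * ⟪D u, u⟫_ℝ := by
  have h := h0 (M • u - D u)
  have h2 := h1 (D u)
  simp only [map_sub, map_smul, inner_sub_left, inner_sub_right, real_inner_smul_left,
    real_inner_smul_right, real_inner_self_eq_norm_sq, hD (D u) u] at h
  have : M * ‖D u‖ ^ 2 ≤ M * (M * ⟪D u, u⟫_ℝ) := by linarith
  exact le_of_mul_le_mul_left this hM

theorem norm_sq_le_of_norm_sq_le {T : E →L[ℝ] F} {M : ℝ} (hT : ‖T‖ ^ 2 ≤ M) (v : E) :
    ‖T v‖ ^ 2 ≤ M * ‖v‖ ^ 2 := by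
  have := T.le_opNorm v
  calc ‖T v‖ ^ 2 ≤ (‖T‖ * ‖v‖) ^ 2 := by gcongr
    _ = ‖T‖ ^ 2 * ‖v‖ ^ 2 := by ring
    _ ≤ _ := by gcongr

/-- The gradient flow of `‖T‖⁴` shrinks an operator bounded by `s` at least as much as the scalar
map `s ↦ s (1 - η s²)`. -/
theorem norm_apply_sub_smul_adjoint_le {T : E →L[ℝ] F} {s η : ℝ} (hs : ‖T‖ ≤ s) (hη : 0 ≤ η)
    (h : 4 * η * s ^ 2 ≤ 1) (v : E) :
    ‖T (v - η • T.adjoint (T v))‖ ≤ s * (1 - η * s ^ 2) * ‖v‖ := by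
  have hs0 : 0 ≤ s := (norm_nonneg _).trans hs
  have hp : 0 ≤ η * s ^ 2 := by positivity
  have h1 : ‖T (T.adjoint (T v))‖ ^ 2 ≤ s ^ 2 * ‖T.adjoint (T v)‖ ^ 2 :=
    norm_sq_le_of_norm_sq_le (by gcongr) _
  have h2 : ‖T v‖ ^ 2 ≤ s ^ 2 * ‖v‖ ^ 2 := norm_sq_le_of_norm_sq_le (by gcongr) _
  have h3 : ⟪T v, T (T.adjoint (T v))⟫_ℝ = ‖T.adjoint (T v)‖ ^ 2 := by
    rw [← ContinuousLinearMap.adjoint_inner_left, real_inner_self_eq_norm_sq]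
  have h4 : ‖T v‖ ^ 2 ≤ ‖T.adjoint (T v)‖ * ‖v‖ := by
    rw [← real_inner_self_eq_norm_sq, ← ContinuousLinearMap.adjoint_inner_left]
    exact real_inner_le_norm _ _
  apply le_of_sq_le_sq _ (by have : 0 ≤ 1 - η * s ^ 2 := by linarith
                             positivity)
  rw [map_sub, map_smul, norm_sub_sq_real, real_inner_smul_right, h3, norm_smul,
    Real.norm_of_nonneg hη]
  set a := ‖T v‖ ^ 2
  set b := ‖T.adjoint (T v)‖
  set N := ‖v‖
  have h5 : a - (2 * η - η ^ 2 * s ^ 2) * b ^ 2 ≤ (s * (1 - η * s ^ 2) * N) ^ 2 := by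
    have hN : 0 ≤ N := norm_nonneg _
    have ha : 0 ≤ a := by positivity
    have hk : 0 ≤ 2 * η - η ^ 2 * s ^ 2 := by nlinarith
    rcases hN.eq_or_lt with h0 | h0
    · have : a = 0 := by rw [← h0] at h2; nlinarith
      rw [this, ← h0]; nlinarith [mul_nonneg hk (sq_nonneg b)]
    · have h6 : a ^ 2 ≤ b ^ 2 * N ^ 2 := by
        calc a ^ 2 ≤ (b * N) ^ 2 := by gcongr
          _ = _ := by ring
      have h7 : (a - (2 * η - η ^ 2 * s ^ 2) * b ^ 2) * N ^ 2
          ≤ (s * (1 - η * s ^ 2) * N) ^ 2 * N ^ 2 := by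
        have h8 := mul_le_mul_of_nonneg_left h6 hk
        have h9 : 0 ≤ (s ^ 2 * N ^ 2 - a) *
            (N ^ 2 - (2 * η - η ^ 2 * s ^ 2) * (a + s ^ 2 * N ^ 2)) := by
          apply mul_nonneg (by linarith)
          have : (2 * η - η ^ 2 * s ^ 2) * (a + s ^ 2 * N ^ 2) ≤
              (2 * η) * (s ^ 2 * N ^ 2 + s ^ 2 * N ^ 2) := by
            gcongr
            nlinarith [sq_nonneg (η * s)]
          nlinarith [sq_nonneg N]
        nlinarith
      exact le_of_mul_le_mul_right h7 (by positivity)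
  nlinarith

theorem norm_sq_gradStep_le {T : E →L[ℝ] F} {S : F →L[ℝ] F} {l η : ℝ} (hS : ‖S‖ ≤ l) (hη : 0 ≤ η)
    (hl : 8 * η * l ≤ 1) (hT : ‖T‖ ^ 2 ≤ 2 * l) :
    ‖T + η • (S ∘L T - T ∘L (T.adjoint ∘L T))‖ ^ 2 ≤ 2 * l := by
  have hl0 : 0 ≤ l := (norm_nonneg _).trans hS
  have hs : √(2 * l) ^ 2 = 2 * l := Real.sq_sqrt (by linarith)
  have hTs : ‖T‖ ≤ √(2 * l) := Real.le_sqrt_of_sq_le hT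
  rw [← hs]
  gcongr
  refine ContinuousLinearMap.opNorm_le_bound _ (by positivity) fun v => ?_
  have h1 := norm_apply_sub_smul_adjoint_le hTs hη (by rw [hs]; linarith) v
  have h2 : ‖S (T v)‖ ≤ l * (√(2 * l) * ‖v‖) :=
    (S.le_of_opNorm_le hS _).trans (by gcongr; exact T.le_of_opNorm_le hTs v)
  have : (T + η • (S ∘L T - T ∘L (T.adjoint ∘L T))) v =
      T (v - η • T.adjoint (T v)) + η • S (T v) := by
    simp; module
  rw [this]
  refine (norm_add_le _ _).trans ?_
  rw [norm_smul, Real.norm_of_nonneg hη]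
  rw [hs] at h1
  have h3 := mul_le_mul_of_nonneg_left h2 hη
  have h4 : 0 ≤ η * l * (√(2 * l) * ‖v‖) := by positivity
  linarith

/-- Numerical relations between the step size `η` and the bounds `l = λ₁`, `m = λ_r`, `Δ` on the
spectrum. -/
structure StepBounds (η l m Δ : ℝ) : Prop where
  η_pos : 0 < η
  Δ_pos : 0 < Δ
  Δ_le : Δ ≤ m
  m_le : m ≤ l
  cube : 36 * (η * l ^ 3) ≤ Δ ^ 2

namespace StepBounds
variable {η l m Δ : ℝ} (h : StepBounds η l m Δ)
include h

theorem l_pos : 0 < l := h.Δ_pos.trans_le (h.Δ_le.trans h.m_le)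

theorem sq : 36 * (η * l ^ 2) ≤ Δ := by
  have := h.l_pos
  have h1 : 36 * (η * l ^ 2) * l ≤ Δ * l := by
    nlinarith [h.cube, mul_le_mul_of_nonneg_left (h.Δ_le.trans h.m_le) h.Δ_pos.le]
  exact le_of_mul_le_mul_right h1 this

theorem lin : 36 * (η * l) ≤ 1 := by
  have := h.l_pos
  have h1 : 36 * (η * l) * l ≤ 1 * l := by nlinarith [h.sq, h.Δ_le, h.m_le]
  exact le_of_mul_le_mul_right h1 this

end StepBounds
theorem norm_sq_botStep_le {η l m Δ : ℝ} (h : StepBounds η l m Δ) {U : E →L[ℝ] F} {J : E →L[ℝ] G}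
    {S : G →L[ℝ] G} (hS : ‖S‖ ≤ m - Δ) (hU : ‖U‖ ^ 2 ≤ 2 * l) (hJ : ‖J‖ ^ 2 ≤ m - Δ / 2) :
    ‖J + η • (S ∘L J - J ∘L (U.adjoint ∘L U + J.adjoint ∘L J))‖ ^ 2 ≤ m - Δ / 2 := by
  have hη := h.η_pos
  have hΔ := h.Δ_pos
  have hl := h.l_pos
  have hm := h.Δ_le
  have hml := h.m_le
  set j := √(m - Δ / 2) with hj
  have hj0 : 0 ≤ j := Real.sqrt_nonneg _
  have hjs : j ^ 2 = m - Δ / 2 := Real.sq_sqrt (by linarith)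
  have hJj : ‖J‖ ≤ j := Real.le_sqrt_of_sq_le hJ
  have h4 : 4 * η * j ^ 2 ≤ 1 := by rw [hjs]; nlinarith [h.lin]
  rw [← hjs]
  gcongr
  refine ContinuousLinearMap.opNorm_le_bound _ hj0 fun v => ?_
  have hW : ‖U.adjoint (U v)‖ ≤ 2 * l * ‖v‖ := by
    calc _ ≤ ‖U‖ * (‖U‖ * ‖v‖) :=
          (ContinuousLinearMap.le_opNorm _ _).trans (by
            rw [LinearIsometryEquiv.norm_map]; gcongr; exact U.le_opNorm v)
      _ = ‖U‖ ^ 2 * ‖v‖ := by ring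
      _ ≤ _ := by gcongr
  have hw : ‖v - η • U.adjoint (U v)‖ ≤ ‖v‖ := by
    apply le_of_sq_le_sq _ (norm_nonneg _)
    have h1 : ⟪v, U.adjoint (U v)⟫_ℝ = ‖U v‖ ^ 2 := by
      rw [ContinuousLinearMap.adjoint_inner_right, real_inner_self_eq_norm_sq]
    have h2 : ‖U.adjoint (U v)‖ ^ 2 ≤ 2 * l * ‖U v‖ ^ 2 :=
      norm_sq_le_of_norm_sq_le (by rw [LinearIsometryEquiv.norm_map]; exact hU) _
    rw [norm_sub_sq_real, real_inner_smul_right, h1, norm_smul, Real.norm_of_nonneg hη.le]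
    have h3 := mul_le_mul_of_nonneg_left h2 (sq_nonneg η)
    have h5 : η * l * (η * ‖U v‖ ^ 2) ≤ 1 / 36 * (η * ‖U v‖ ^ 2) := by
      gcongr; linarith [h.lin]
    have : 0 ≤ η * ‖U v‖ ^ 2 := by positivity
    nlinarith
  have e1 := norm_apply_sub_smul_adjoint_le hJj hη.le h4 (v - η • U.adjoint (U v))
  have e2 : ‖S (J v)‖ ≤ (m - Δ) * (j * ‖v‖) :=
    (S.le_of_opNorm_le hS _).trans (by
      exact mul_le_mul_of_nonneg_left (J.le_of_opNorm_le hJj v) (by linarith))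
  have e3 : ‖J (J.adjoint (J (U.adjoint (U v))))‖ ≤ j * (j * (j * (2 * l * ‖v‖))) := by
    refine (J.le_of_opNorm_le hJj _).trans ?_
    gcongr
    refine (J.adjoint.le_of_opNorm_le (by rwa [LinearIsometryEquiv.norm_map] : _ ≤ j) _).trans ?_
    gcongr
    refine (J.le_of_opNorm_le hJj _).trans ?_
    gcongr
  have key : (J + η • (S ∘L J - J ∘L (U.adjoint ∘L U + J.adjoint ∘L J))) v =
      J ((v - η • U.adjoint (U v)) - η • J.adjoint (J (v - η • U.adjoint (U v)))) + η • S (J v)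
        - η ^ 2 • J (J.adjoint (J (U.adjoint (U v)))) := by
    simp; module
  rw [key]
  refine (norm_sub_le _ _).trans ((add_le_add_left (norm_add_le _ _) _).trans ?_)
  rw [norm_smul, norm_smul, Real.norm_of_nonneg hη.le, Real.norm_of_nonneg (sq_nonneg η)]
  have e4 := mul_le_mul_of_nonneg_left e2 hη.le
  have e5 := mul_le_mul_of_nonneg_left e3 (sq_nonneg η)
  have e6 : j * (1 - η * j ^ 2) * ‖v - η • U.adjoint (U v)‖ ≤ j * (1 - η * j ^ 2) * ‖v‖ := by
    have : 0 ≤ 1 - η * j ^ 2 := by nlinarith [mul_nonneg hη.le (sq_nonneg j)]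
    gcongr
  have e7 : η ^ 2 * (j * (j * (j * (2 * l * ‖v‖)))) = η * (j * ‖v‖) * (2 * (η * l * j ^ 2)) := by
    ring
  have e8 : 2 * (η * l * j ^ 2) ≤ Δ / 18 := by
    have : η * l * j ^ 2 ≤ η * l * l := by gcongr; linarith
    linarith [h.sq]
  have e9 : η * (j * ‖v‖) * (2 * (η * l * j ^ 2)) ≤ η * (j * ‖v‖) * (Δ / 18) := by gcongr
  have e10 : 0 ≤ η * (j * ‖v‖) * Δ := by positivity
  rw [hjs] at e6 e1
  nlinarith

/-- The lower bound on the smallest singular value of the top block is preserved, stated for the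
adjoint. -/
theorem le_norm_sq_adjoint_topStep {η l m Δ : ℝ} (h : StepBounds η l m Δ) {U : E →L[ℝ] F}
    {J : E →L[ℝ] G} {L : F →L[ℝ] F} (hL : ‖L‖ ≤ l) (hLs : L.adjoint = L)
    (hLm : ∀ x, m * ‖x‖ ^ 2 ≤ ⟪L x, x⟫_ℝ) (hU : ‖U‖ ^ 2 ≤ 2 * l) (hJ : ‖J‖ ^ 2 ≤ m - Δ / 2)
    (hlow : ∀ u, Δ / 4 * ‖u‖ ^ 2 ≤ ‖U.adjoint u‖ ^ 2) (u : F) :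
    Δ / 4 * ‖u‖ ^ 2 ≤
      ‖(U + η • (L ∘L U - U ∘L (U.adjoint ∘L U + J.adjoint ∘L J))).adjoint u‖ ^ 2 := by
  have hη := h.η_pos
  have hΔ := h.Δ_pos
  have hl := h.l_pos
  have hm := h.Δ_le
  have hml := h.m_le
  have hUa : ‖U.adjoint‖ ^ 2 ≤ 2 * l := by rwa [LinearIsometryEquiv.norm_map]
  set D : F →L[ℝ] F := U ∘L U.adjoint - (Δ / 4) • ContinuousLinearMap.id ℝ F with hD
  have hDa : ∀ x, D x = U (U.adjoint x) - (Δ / 4) • x := fun x => by simp [hD]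
  have hWW : ∀ x y, ⟪U (U.adjoint x), y⟫_ℝ = ⟪U.adjoint x, U.adjoint y⟫_ℝ := fun x y => by
    rw [ContinuousLinearMap.adjoint_inner_right]
  have hDi : ∀ x y, ⟪D x, y⟫_ℝ = ⟪U.adjoint x, U.adjoint y⟫_ℝ - Δ / 4 * ⟪x, y⟫_ℝ := fun x y => by
    rw [hDa, inner_sub_left, hWW, real_inner_smul_left]
  have hDs : ∀ x y, ⟪D x, y⟫_ℝ = ⟪x, D y⟫_ℝ := fun x y => by
    rw [hDi, real_inner_comm (D y), hDi, real_inner_comm (U.adjoint x), real_inner_comm x y]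
  have hD0 : ∀ x, 0 ≤ ⟪D x, x⟫_ℝ := fun x => by
    rw [hDi, real_inner_self_eq_norm_sq, real_inner_self_eq_norm_sq]; linarith [hlow x]
  have hD1 : ∀ x, ⟪D x, x⟫_ℝ ≤ 2 * l * ‖x‖ ^ 2 := fun x => by
    rw [hDi, real_inner_self_eq_norm_sq, real_inner_self_eq_norm_sq]
    have := norm_sq_le_of_norm_sq_le hUa x
    have : 0 ≤ Δ / 4 * ‖x‖ ^ 2 := by positivity
    linarith
  have hDD := norm_sq_apply_le_of_psd hDs (by positivity) hD0 hD1 u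
  have hxu : ‖U.adjoint u‖ ^ 2 = ⟪D u, u⟫_ℝ + Δ / 4 * ‖u‖ ^ 2 := by
    rw [hDi, real_inner_self_eq_norm_sq, real_inner_self_eq_norm_sq]; ring
  have hW : U (U.adjoint u) = D u + (Δ / 4) • u := by rw [hDa]; module
  have hWsq : ‖U (U.adjoint u)‖ ^ 2 =
      ‖D u‖ ^ 2 + Δ / 2 * ⟪D u, u⟫_ℝ + (Δ / 4) ^ 2 * ‖u‖ ^ 2 := by
    rw [hW, norm_add_sq_real, norm_smul, Real.norm_of_nonneg (by positivity),
      real_inner_smul_right]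
    ring
  have hJu := norm_sq_le_of_norm_sq_le hJ (U.adjoint u)
  have hWL : ⟪U (U.adjoint u), L u⟫_ℝ = ⟪D u, L u⟫_ℝ + Δ / 4 * ⟪L u, u⟫_ℝ := by
    rw [hW, inner_add_left, real_inner_smul_left, real_inner_comm u]
  have hcross : 0 ≤ ⟪D u, u⟫_ℝ + 4 * η * ⟪D u, L u⟫_ℝ + 4 * η ^ 2 * ⟪D (L u), L u⟫_ℝ := by
    have := hD0 (u + (2 * η) • L u)
    simp only [map_add, map_smul, inner_add_left, inner_add_right, real_inner_smul_left,
      real_inner_smul_right] at this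
    rw [hDs (L u) u, real_inner_comm (D u)] at this
    linarith
  have hLu : ⟪D (L u), L u⟫_ℝ ≤ 2 * l * (l ^ 2 * ‖u‖ ^ 2) :=
    (hD1 _).trans (by gcongr; exact norm_sq_le_of_norm_sq_le (by gcongr) u)
  have hLm' := hLm u
  have hexp : ‖U.adjoint u‖ ^ 2 + 2 * η * (⟪U (U.adjoint u), L u⟫_ℝ - ‖U (U.adjoint u)‖ ^ 2
      - ‖J (U.adjoint u)‖ ^ 2) ≤
      ‖(U + η • (L ∘L U - U ∘L (U.adjoint ∘L U + J.adjoint ∘L J))).adjoint u‖ ^ 2 := by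
    have e : (U + η • (L ∘L U - U ∘L (U.adjoint ∘L U + J.adjoint ∘L J))).adjoint u =
        U.adjoint u + η • (U.adjoint (L u) - U.adjoint (U (U.adjoint u))
          - J.adjoint (J (U.adjoint u))) := by
      simp [ContinuousLinearMap.adjoint_comp, hLs]
      module
    rw [e, norm_add_sq_real, real_inner_smul_right, inner_sub_right, inner_sub_right,
      ContinuousLinearMap.adjoint_inner_right, ContinuousLinearMap.adjoint_inner_right,
      ContinuousLinearMap.adjoint_inner_right, real_inner_self_eq_norm_sq,
      real_inner_self_eq_norm_sq]
    have := sq_nonneg ‖η • (U.adjoint (L u) - U.adjoint (U (U.adjoint u))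
          - J.adjoint (J (U.adjoint u)))‖
    linarith
  refine le_trans ?_ hexp
  have hδ := hD0 u
  have hN : 0 ≤ ‖u‖ ^ 2 := by positivity
  rw [hWsq, hWL]
  rw [hxu] at hJu ⊢
  set δ := ⟪D u, u⟫_ℝ
  set N := ‖u‖ ^ 2
  set q := ⟪D u, L u⟫_ℝ
  have f1 : 2 * η * q ≥ - δ / 2 - 4 * (η ^ 2 * l ^ 3) * N := by
    have := mul_le_mul_of_nonneg_left hLu (sq_nonneg η)
    linarith
  have f2 : 2 * η * (Δ / 4 * ⟪L u, u⟫_ℝ) ≥ 2 * η * (Δ / 4 * (m * N)) := by gcongr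
  have f3 : 2 * η * (‖D u‖ ^ 2 + Δ / 2 * δ + (Δ / 4) ^ 2 * N + ‖J (U.adjoint u)‖ ^ 2) ≤
      2 * η * (2 * l * δ + Δ / 2 * δ + (Δ / 4) ^ 2 * N + (m - Δ / 2) * (δ + Δ / 4 * N)) := by
    gcongr
  have f4 : 0 ≤ (1 / 2 - η * (4 * l + 2 * m)) * δ := by
    have : η * (4 * l + 2 * m) ≤ η * (4 * l + 2 * l) := by gcongr
    have := h.lin
    apply mul_nonneg _ hδ
    linarith
  have f5 : 0 ≤ η * ((Δ ^ 2 / 8 - 4 * (η * l ^ 3)) * N) := by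
    have : 0 ≤ Δ ^ 2 / 8 - 4 * (η * l ^ 3) := by linarith [h.cube, sq_nonneg Δ]
    positivity
  linarith

/-- One step decreases the ratio `‖J v‖ / ‖U v‖` by a factor `1 - ηΔ/2`. -/
theorem norm_botStep_le_norm_topStep {η l m Δ g : ℝ} (h : StepBounds η l m Δ) {U : E →L[ℝ] F}
    {J : E →L[ℝ] G} {L : F →L[ℝ] F} {S : G →L[ℝ] G} (hL : ‖L‖ ≤ l)
    (hLm : ∀ x, m * ‖x‖ ^ 2 ≤ ⟪L x, x⟫_ℝ) (hS : ‖S‖ ≤ m - Δ) (hU : ‖U‖ ^ 2 ≤ 2 * l)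
    (hA : ‖U.adjoint ∘L U + J.adjoint ∘L J‖ ≤ 2 * l)
    (hlow : ∀ v, Δ / 4 * ‖v‖ ^ 2 ≤ ‖U v‖ ^ 2) (hg : 0 ≤ g) (hJU : ∀ v, ‖J v‖ ≤ g * ‖U v‖) (v : E) :
    ‖(J + η • (S ∘L J - J ∘L (U.adjoint ∘L U + J.adjoint ∘L J))) v‖ ≤
      g * (1 - η * Δ / 2) *
        ‖(U + η • (L ∘L U - U ∘L (U.adjoint ∘L U + J.adjoint ∘L J))) v‖ := by
  have hη := h.η_pos
  have hΔ := h.Δ_pos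
  have hl := h.l_pos
  have hm := h.Δ_le
  have hml := h.m_le
  set A := U.adjoint ∘L U + J.adjoint ∘L J
  obtain ⟨w, hw⟩ : ∃ w, w = v - η • A v := ⟨_, rfl⟩
  have hv : v = w + η • A v := by rw [hw]; module
  have hAv : ‖A v‖ ≤ 2 * l * ‖v‖ := A.le_of_opNorm_le hA v
  have hvw : ‖v‖ ≤ 18 / 17 * ‖w‖ := by
    have h1 : ‖v‖ ≤ ‖w‖ + η * (2 * l * ‖v‖) := by
      calc ‖v‖ = ‖w + η • A v‖ := by rw [← hv]
        _ ≤ ‖w‖ + η * ‖A v‖ := by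
          refine (norm_add_le _ _).trans ?_
          rw [norm_smul, Real.norm_of_nonneg hη.le]
        _ ≤ _ := by gcongr
    nlinarith [h.lin, norm_nonneg v]
  set y := ‖U (A v)‖ with hy
  have hy2 : y ^ 2 ≤ 2 * l * (2 * l * (18 / 17 * ‖w‖)) ^ 2 :=
    (norm_sq_le_of_norm_sq_le hU _).trans (by gcongr; exact hAv.trans (by gcongr))
  have hyw : η * l * y ≤ 1 / 5 * Δ * ‖U w‖ := by
    apply le_of_sq_le_sq _ (by positivity)
    have h1 := hlow w
    have h2 : 1296 * (η ^ 2 * l ^ 5) ≤ Δ ^ 3 := by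
      have := mul_le_mul h.cube h.sq (by positivity) (by positivity)
      nlinarith
    calc (η * l * y) ^ 2 = (η * l) ^ 2 * y ^ 2 := by ring
      _ ≤ (η * l) ^ 2 * (2 * l * (2 * l * (18 / 17 * ‖w‖)) ^ 2) := by gcongr
      _ = (8 * (18 / 17) ^ 2) * (η ^ 2 * l ^ 5) * ‖w‖ ^ 2 := by ring
      _ ≤ (8 * (18 / 17) ^ 2) * (Δ ^ 3 / 1296) * ‖w‖ ^ 2 := by gcongr; linarith
      _ = (32 * (18 / 17) ^ 2 / 1296) * Δ ^ 2 * (Δ / 4 * ‖w‖ ^ 2) := by ring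
      _ ≤ (1 / 25) * Δ ^ 2 * ‖U w‖ ^ 2 := by gcongr ?_ * _ * ?_; norm_num
      _ = _ := by ring
  have hJ' : ‖(J + η • (S ∘L J - J ∘L A)) v‖ ≤
      (1 + η * (m - Δ)) * (g * ‖U w‖) + η ^ 2 * (l * (g * y)) := by
    have e : (J + η • (S ∘L J - J ∘L A)) v = J w + η • S (J w) + η ^ 2 • S (J (A v)) := by
      have : S (J v) = S (J w) + η • S (J (A v)) := by
        rw [← map_smul, ← map_smul, ← map_add, ← map_add, ← hv]
      simp [this]; rw [hw]; simp; module
    have e1 : ‖S (J w)‖ ≤ (m - Δ) * (g * ‖U w‖) :=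
      (S.le_of_opNorm_le hS _).trans (by
        exact mul_le_mul_of_nonneg_left (hJU w) (by linarith))
    have e2 : ‖S (J (A v))‖ ≤ l * (g * y) :=
      (S.le_of_opNorm_le (hS.trans (by linarith : m - Δ ≤ l)) _).trans (by gcongr; exact hJU _)
    rw [e]
    refine (norm_add_le _ _).trans ((add_le_add_left (norm_add_le _ _) _).trans ?_)
    rw [norm_smul, norm_smul, Real.norm_of_nonneg hη.le, Real.norm_of_nonneg (sq_nonneg η)]
    have e3 := hJU w
    have e4 := mul_le_mul_of_nonneg_left e1 hη.le
    have e5 := mul_le_mul_of_nonneg_left e2 (sq_nonneg η)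
    linarith
  have hU' : (1 + η * m) * ‖U w‖ - η ^ 2 * (l * y) ≤ ‖(U + η • (L ∘L U - U ∘L A)) v‖ := by
    have e : (U + η • (L ∘L U - U ∘L A)) v = (U w + η • L (U w)) + η ^ 2 • L (U (A v)) := by
      have : L (U v) = L (U w) + η • L (U (A v)) := by
        rw [← map_smul, ← map_smul, ← map_add, ← map_add, ← hv]
      simp [this]; rw [hw]; simp; module
    have e1 : ‖L (U (A v))‖ ≤ l * y := L.le_of_opNorm_le hL _
    have e2 : (1 + η * m) * ‖U w‖ ≤ ‖U w + η • L (U w)‖ := by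
      rcases (norm_nonneg (U w)).eq_or_lt with h0 | h0
      · rw [← h0, mul_zero]; exact norm_nonneg _
      · have e3 := real_inner_le_norm (U w + η • L (U w)) (U w)
        rw [inner_add_left, real_inner_smul_left, real_inner_self_eq_norm_sq] at e3
        have e4 := mul_le_mul_of_nonneg_left (hLm (U w)) hη.le
        refine le_of_mul_le_mul_right ?_ h0
        nlinarith
    rw [e]
    have e3 := norm_sub_norm_le (U w + η • L (U w)) (-(η ^ 2 • L (U (A v))))
    rw [norm_neg, sub_neg_eq_add, norm_smul, Real.norm_of_nonneg (sq_nonneg η)] at e3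
    have e5 := mul_le_mul_of_nonneg_left e1 (sq_nonneg η)
    linarith
  have he : η * Δ ≤ 1 / 36 := by nlinarith [h.lin]
  have he0 : 0 < η * Δ := by positivity
  have ha : η * m ≤ 1 / 36 := by nlinarith [h.lin]
  have hq : 0 ≤ 1 - η * Δ / 2 := by linarith
  refine hJ'.trans (le_trans ?_ (mul_le_mul_of_nonneg_left hU' (by positivity)))
  rw [mul_assoc]
  have : (1 + η * (m - Δ)) * (g * ‖U w‖) + η ^ 2 * (l * (g * y)) =
    g * ((1 + η * (m - Δ)) * ‖U w‖ + η * (η * l * y)) := by ring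
  rw [this]
  refine mul_le_mul_of_nonneg_left ?_ hg
  have k1 := mul_le_mul_of_nonneg_left hyw hη.le
  have k2 := mul_le_mul_of_nonneg_left k1 hq
  have k3 : 0 ≤ η * Δ * ‖U w‖ := by positivity
  have k4 : 0 ≤ (1 / 36 - η * m) * (η * Δ * ‖U w‖) := mul_nonneg (by linarith) k3
  have k5 : 0 ≤ (1 / 36 - η * Δ) * (η * Δ * ‖U w‖) := mul_nonneg (by linarith) k3
  nlinarith

theorem norm_sub_comp_adjoint_le {l : ℝ} {U : E →L[ℝ] F} {L : F →L[ℝ] F} (hl : 0 < l)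
    (hL : ‖L‖ ≤ l) (hLs : L.adjoint = L) (hL0 : ∀ x, 0 ≤ ⟪L x, x⟫_ℝ) (hU : ‖U‖ ^ 2 ≤ 2 * l) :
    ‖L - U ∘L U.adjoint‖ ≤ 2 * l := by
  refine ContinuousLinearMap.opNorm_le_bound _ (by positivity) fun u => ?_
  have hLsymm : ∀ x y, ⟪L x, y⟫_ℝ = ⟪x, L y⟫_ℝ := fun x y => by
    conv_lhs => rw [← hLs, ContinuousLinearMap.adjoint_inner_left]
  have hL1 : ∀ x, ⟪L x, x⟫_ℝ ≤ l * ‖x‖ ^ 2 := fun x => by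
    have h1 := real_inner_le_norm (L x) x
    have h2 := mul_le_mul_of_nonneg_right (L.le_of_opNorm_le hL x) (norm_nonneg x)
    linarith
  have h1 : ‖L u - (l / 2) • u‖ ≤ l / 2 * ‖u‖ := by
    apply le_of_sq_le_sq _ (by positivity)
    have := norm_sq_apply_le_of_psd hLsymm hl hL0 hL1 u
    rw [norm_sub_sq_real, norm_smul, Real.norm_of_nonneg (by positivity), real_inner_smul_right]
    linarith
  have h2 : ‖U (U.adjoint u) - l • u‖ ≤ l * ‖u‖ := by
    apply le_of_sq_le_sq _ (by positivity)
    have := norm_sq_le_of_norm_sq_le hU (U.adjoint u)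
    rw [norm_sub_sq_real, norm_smul, Real.norm_of_nonneg (by positivity), real_inner_smul_right,
      ← ContinuousLinearMap.adjoint_inner_right, real_inner_self_eq_norm_sq]
    linarith
  have e : (L - U ∘L U.adjoint) u =
      (L u - (l / 2) • u) - (U (U.adjoint u) - l • u) - (l / 2) • u := by
    simp; module
  rw [e]
  refine (norm_sub_le _ _).trans ((add_le_add_left (norm_sub_le _ _) _).trans ?_)
  rw [norm_smul, Real.norm_of_nonneg (by positivity)]
  linarith

theorem norm_sub_smul_comp_adjoint_le {c M η : ℝ} {U : E →L[ℝ] F} (hU : ‖U‖ ^ 2 ≤ M)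
    (hη : 0 ≤ η) (hM : η * M ≤ 1) (hc : η * c < 1) (hlow : ∀ u, c * ‖u‖ ^ 2 ≤ ‖U.adjoint u‖ ^ 2)
    (u : F) : ‖u - η • U (U.adjoint u)‖ ≤ (1 - η * c) * ‖u‖ := by
  set D : F →L[ℝ] F := ContinuousLinearMap.id ℝ F - η • (U ∘L U.adjoint) with hD
  have hDa : ∀ x, D x = x - η • U (U.adjoint x) := fun x => by simp [hD]
  have hDi : ∀ x y, ⟪D x, y⟫_ℝ = ⟪x, y⟫_ℝ - η * ⟪U.adjoint x, U.adjoint y⟫_ℝ := fun x y => by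
    rw [hDa, inner_sub_left, real_inner_smul_left, ContinuousLinearMap.adjoint_inner_right]
  have hDs : ∀ x y, ⟪D x, y⟫_ℝ = ⟪x, D y⟫_ℝ := fun x y => by
    rw [hDi, real_inner_comm (D y), hDi, real_inner_comm (U.adjoint x), real_inner_comm x y]
  have hDx : ∀ x, ⟪D x, x⟫_ℝ = ‖x‖ ^ 2 - η * ‖U.adjoint x‖ ^ 2 := fun x => by
    rw [hDi, real_inner_self_eq_norm_sq, real_inner_self_eq_norm_sq]
  have hD0 : ∀ x, 0 ≤ ⟪D x, x⟫_ℝ := fun x => by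
    have h1 : ‖U.adjoint x‖ ^ 2 ≤ M * ‖x‖ ^ 2 :=
      norm_sq_le_of_norm_sq_le (by rwa [LinearIsometryEquiv.norm_map]) x
    have h2 := mul_le_mul_of_nonneg_left h1 hη
    have h3 := mul_le_mul_of_nonneg_right hM (sq_nonneg ‖x‖)
    rw [hDx]; linarith
  have hD1 : ∀ x, ⟪D x, x⟫_ℝ ≤ (1 - η * c) * ‖x‖ ^ 2 := fun x => by
    rw [hDx]; linarith [mul_le_mul_of_nonneg_left (hlow x) hη]
  have hc' : 0 < 1 - η * c := by linarith
  have h1 := norm_sq_apply_le_of_psd hDs hc' hD0 hD1 u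
  have h2 := mul_le_mul_of_nonneg_left (hD1 u) hc'.le
  rw [← hDa]
  exact le_of_sq_le_sq (by linarith) (by positivity)

theorem norm_sub_add_sub_add_add_sub_le {a b : ℝ} (ha : 0 ≤ a) (hb : 0 ≤ b)
    (x₁ x₂ x₃ x₄ x₅ x₆ x₇ : F) :
    ‖x₁ - a • x₂ + b • x₃ - a • x₄ + a • x₅ + a • x₆ - a • x₇‖ ≤ ‖x₁‖ + a * ‖x₂‖ + b * ‖x₃‖
      + a * ‖x₄‖ + a * ‖x₅‖ + a * ‖x₆‖ + a * ‖x₇‖ := by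
  have k : ∀ x : F, ‖a • x‖ = a * ‖x‖ := fun x => by rw [norm_smul, Real.norm_of_nonneg ha]
  have k' : ‖b • x₃‖ = b * ‖x₃‖ := by rw [norm_smul, Real.norm_of_nonneg hb]
  rw [← k, ← k, ← k, ← k, ← k, ← k']
  refine (norm_sub_le _ _).trans (add_le_add_left ?_ _)
  refine (norm_add_le _ _).trans (add_le_add_left ?_ _)
  refine (norm_add_le _ _).trans (add_le_add_left ?_ _)
  refine (norm_sub_le _ _).trans (add_le_add_left ?_ _)
  refine (norm_add_le _ _).trans (add_le_add_left ?_ _)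
  exact norm_sub_le _ _

set_option maxHeartbeats 1000000 in
/-- One step contracts the residual `L - U U†`, up to a term quadratic in `J U†`. -/
theorem norm_residual_topStep_le {η l m Δ p n : ℝ} (h : StepBounds η l m Δ) {U : E →L[ℝ] F}
    {J : E →L[ℝ] G} {L : F →L[ℝ] F} (hL : ‖L‖ ≤ l) (hLs : L.adjoint = L)
    (hLm : ∀ x, m * ‖x‖ ^ 2 ≤ ⟪L x, x⟫_ℝ) (hU : ‖U‖ ^ 2 ≤ 2 * l) (hJ : ‖J‖ ^ 2 ≤ m - Δ / 2)
    (hlow : ∀ u, Δ / 4 * ‖u‖ ^ 2 ≤ ‖U.adjoint u‖ ^ 2)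
    (hp : ‖L - U ∘L U.adjoint‖ ≤ p) (hn : ‖J ∘L U.adjoint‖ ≤ n)
    {U' : E →L[ℝ] F}
    (hU' : U' = U + η • (L ∘L U - U ∘L (U.adjoint ∘L U + J.adjoint ∘L J))) :
    ‖L - U' ∘L U'.adjoint‖ ≤ (1 - η * Δ / 4) * p + 3 * η * n ^ 2 := by
  have hη := h.η_pos
  have hΔ := h.Δ_pos
  have hl := h.l_pos
  have hm := h.Δ_le
  have hml := h.m_le
  have hp0 : 0 ≤ p := (norm_nonneg _).trans hp
  have hn0 : 0 ≤ n := (norm_nonneg _).trans hn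
  have he : η * Δ ≤ 1 / 36 := by nlinarith [h.lin]
  have he0 : 0 < η * Δ := by positivity
  have hP2 := norm_sub_comp_adjoint_le hl hL hLs
    (fun x => le_trans (by have := hΔ.trans_le hm; positivity) (hLm x)) hU
  obtain ⟨P, hP⟩ : ∃ P, P = L - U ∘L U.adjoint := ⟨_, rfl⟩
  rw [← hP] at hp hP2
  obtain ⟨K, hK⟩ : ∃ K, K = J ∘L U.adjoint := ⟨_, rfl⟩
  rw [← hK] at hn
  have hKt : ‖K.adjoint‖ ≤ n := by rwa [LinearIsometryEquiv.norm_map]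
  have hKa : ∀ x, K x = J (U.adjoint x) := fun x => by simp [hK]
  have hKta : ∀ x, U (J.adjoint x) = K.adjoint x := fun x => by
    simp [hK, ContinuousLinearMap.adjoint_comp]
  have hLa : ∀ x, L x = P x + U (U.adjoint x) := fun x => by simp [hP]
  have hPs : P.adjoint = P := by
    rw [hP]; simp [ContinuousLinearMap.adjoint_comp, hLs]
  have hU'a : ∀ x, U' x = U x + η • (P (U x) - K.adjoint (J x)) := fun x => by
    rw [hU']; simp [hLa, hKta]; module
  have hU't : ∀ x, U'.adjoint x = U.adjoint x + η • (U.adjoint (P x) - J.adjoint (K x)) := by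
    intro x
    have : U' = U + η • (P ∘L U - K.adjoint ∘L J) := by ext x; simp [hU'a]
    rw [this]; simp [ContinuousLinearMap.adjoint_comp, hPs]
  have hW : ∀ x, ‖U (U.adjoint x)‖ ≤ 2 * l * ‖x‖ := fun x => by
    calc _ ≤ ‖U‖ * (‖U‖ * ‖x‖) :=
          (ContinuousLinearMap.le_opNorm _ _).trans (by
            gcongr
            exact (ContinuousLinearMap.le_opNorm _ _).trans_eq (by
              rw [LinearIsometryEquiv.norm_map]))
      _ = ‖U‖ ^ 2 * ‖x‖ := by ring
      _ ≤ _ := by gcongr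
  have hJJ : ∀ x, ‖J (J.adjoint x)‖ ≤ l * ‖x‖ := fun x => by
    calc _ ≤ ‖J‖ * (‖J‖ * ‖x‖) :=
          (ContinuousLinearMap.le_opNorm _ _).trans (by
            gcongr
            exact (ContinuousLinearMap.le_opNorm _ _).trans_eq (by
              rw [LinearIsometryEquiv.norm_map]))
      _ = ‖J‖ ^ 2 * ‖x‖ := by ring
      _ ≤ _ := by gcongr; linarith
  have hq : 0 ≤ 1 - η * (Δ / 4) := by linarith
  have hB := norm_sub_smul_comp_adjoint_le (c := Δ / 4) hU hη.le (by linarith [h.lin])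
    (by linarith) hlow
  refine ContinuousLinearMap.opNorm_le_bound _ (by
    have : 0 ≤ 1 - η * Δ / 4 := by linarith
    positivity) fun u => ?_
  obtain ⟨v, hv⟩ : ∃ v, v = u - η • U (U.adjoint u) := ⟨_, rfl⟩
  have e : (L - U' ∘L U'.adjoint) u = (P v - η • U (U.adjoint (P v)))
      - η ^ 2 • U (U.adjoint (P (U (U.adjoint u)))) + (2 * η) • K.adjoint (K u)
      - η ^ 2 • P (U (U.adjoint (P u))) + η ^ 2 • P (K.adjoint (K u))
      + η ^ 2 • K.adjoint (K (P u)) - η ^ 2 • K.adjoint (J (J.adjoint (K u))) := by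
    have h1 : U (J.adjoint (K u)) = K.adjoint (K u) := hKta _
    have h2 : J (U.adjoint u) = K u := (hKa _).symm
    have h3 : J (U.adjoint (P u)) = K (P u) := (hKa _).symm
    rw [hv]
    simp only [_root_.sub_apply, ContinuousLinearMap.comp_apply, hU't, hU'a, hLa,
      map_add, map_sub, map_smul, h1, h2, h3]
    module
  have b1 : ‖P v - η • U (U.adjoint (P v))‖ ≤
      (1 - η * (Δ / 4)) * (p * ((1 - η * (Δ / 4)) * ‖u‖)) := by
    refine (hB _).trans ?_
    gcongr
    refine (P.le_of_opNorm_le hp _).trans ?_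
    gcongr
    rw [hv]; exact hB u
  have b2 : ‖U (U.adjoint (P (U (U.adjoint u))))‖ ≤ 2 * l * (p * (2 * l * ‖u‖)) := by
    refine (hW _).trans ?_
    gcongr
    refine (P.le_of_opNorm_le hp _).trans ?_
    gcongr
    exact hW u
  have bK : ∀ x, ‖K x‖ ≤ n * ‖x‖ := fun x => K.le_of_opNorm_le hn x
  have bKt : ∀ x, ‖K.adjoint x‖ ≤ n * ‖x‖ := fun x => K.adjoint.le_of_opNorm_le hKt x
  have bP : ∀ x, ‖P x‖ ≤ 2 * l * ‖x‖ := fun x => P.le_of_opNorm_le hP2 x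
  have b3 : ‖K.adjoint (K u)‖ ≤ n * (n * ‖u‖) := (bKt _).trans (by gcongr; exact bK u)
  have b4 : ‖P (U (U.adjoint (P u)))‖ ≤ 2 * l * (2 * l * (p * ‖u‖)) := by
    refine (bP _).trans ?_
    gcongr
    refine (hW _).trans ?_
    gcongr
    exact P.le_of_opNorm_le hp u
  have b5 : ‖P (K.adjoint (K u))‖ ≤ 2 * l * (n * (n * ‖u‖)) := (bP _).trans (by gcongr)
  have b6 : ‖K.adjoint (K (P u))‖ ≤ n * (n * (2 * l * ‖u‖)) := by
    refine (bKt _).trans ?_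
    gcongr
    refine (bK _).trans ?_
    gcongr
    exact bP u
  have b7 : ‖K.adjoint (J (J.adjoint (K u)))‖ ≤ n * (l * (n * ‖u‖)) := by
    refine (bKt _).trans ?_
    gcongr
    refine (hJJ _).trans ?_
    gcongr
    exact bK u
  have hη2 := sq_nonneg η
  have c2 := mul_le_mul_of_nonneg_left b2 hη2
  have c3 := mul_le_mul_of_nonneg_left b3 (by positivity : 0 ≤ 2 * η)
  have c4 := mul_le_mul_of_nonneg_left b4 hη2
  have c5 := mul_le_mul_of_nonneg_left b5 hη2
  have c6 := mul_le_mul_of_nonneg_left b6 hη2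
  have c7 := mul_le_mul_of_nonneg_left b7 hη2
  rw [e]
  refine (norm_sub_add_sub_add_add_sub_le hη2 (by positivity) _ _ _ _ _ _ _).trans ?_
  have d1 : 0 ≤ (Δ - 36 * (η * l ^ 2)) * (η * (p * ‖u‖)) :=
    mul_nonneg (by linarith [h.sq]) (by positivity)
  have d2 : 0 ≤ (1 - 36 * (η * l)) * (η * (n ^ 2 * ‖u‖)) :=
    mul_nonneg (by linarith [h.lin]) (by positivity)
  have d3 : 0 ≤ (1 / 36 - η * Δ) * (η * Δ * (p * ‖u‖)) :=
    mul_nonneg (by linarith) (by positivity)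
  have d4 : 0 ≤ η * Δ * (p * ‖u‖) := by positivity
  have d5 : 0 ≤ η * (n ^ 2 * ‖u‖) := by positivity
  linarith

theorem le_norm_sq_adjoint [FiniteDimensional ℝ E] [FiniteDimensional ℝ F]
    (hdim : Module.finrank ℝ E = Module.finrank ℝ F) {T : E →L[ℝ] F} {c : ℝ} (hc : 0 < c)
    (hT : ∀ v, c * ‖v‖ ^ 2 ≤ ‖T v‖ ^ 2) (u : F) : c * ‖u‖ ^ 2 ≤ ‖T.adjoint u‖ ^ 2 := by
  have hinj : Function.Injective (T : E →ₗ[ℝ] F) := by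
    rw [injective_iff_map_eq_zero]
    intro v hv
    have h1 := hT v
    rw [show T v = 0 from hv, norm_zero] at h1
    have : ‖v‖ ^ 2 ≤ 0 := by nlinarith
    simpa using this
  obtain ⟨v, rfl⟩ : ∃ v, T v = u :=
    (LinearMap.injective_iff_surjective_of_finrank_eq_finrank hdim).1 hinj u
  have h1 := hT v
  have h2 : ‖T v‖ ^ 2 ≤ ‖T.adjoint (T v)‖ * ‖v‖ := by
    rw [← real_inner_self_eq_norm_sq, ← ContinuousLinearMap.adjoint_inner_left]
    exact real_inner_le_norm _ _
  rcases (sq_nonneg ‖T v‖).eq_or_lt with h0 | h0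
  · rw [← h0]; nlinarith [sq_nonneg ‖T.adjoint (T v)‖]
  · refine le_of_mul_le_mul_right ?_ h0
    have h3 : (‖T v‖ ^ 2) ^ 2 ≤ (‖T.adjoint (T v)‖ * ‖v‖) ^ 2 := by gcongr
    have h4 := mul_le_mul_of_nonneg_left h1 (sq_nonneg ‖T.adjoint (T v)‖)
    have h5 := mul_le_mul_of_nonneg_left h3 hc.le
    nlinarith

theorem norm_residual_le [FiniteDimensional ℝ E] [FiniteDimensional ℝ F]
    (hdim : Module.finrank ℝ E = Module.finrank ℝ F) {η l m Δ : ℝ} (h : StepBounds η l m Δ)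
    {U : ℕ → E →L[ℝ] F} {J : ℕ → E →L[ℝ] G} {L : F →L[ℝ] F} {S : G →L[ℝ] G}
    (hL : ‖L‖ ≤ l) (hLs : L.adjoint = L) (hLm : ∀ x, m * ‖x‖ ^ 2 ≤ ⟪L x, x⟫_ℝ)
    (hS : ‖S‖ ≤ m - Δ)
    (hUt : ∀ t, U (t + 1) = U t + η • (L ∘L U t -
      U t ∘L ((U t).adjoint ∘L U t + (J t).adjoint ∘L J t)))
    (hJt : ∀ t, J (t + 1) = J t + η • (S ∘L J t -
      J t ∘L ((U t).adjoint ∘L U t + (J t).adjoint ∘L J t)))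
    (hX : ∀ t, ‖(U t).adjoint ∘L U t + (J t).adjoint ∘L J t‖ ≤ 2 * l)
    (hJ0 : ‖J 0‖ ^ 2 ≤ m - Δ / 2) (hU0 : ∀ v, Δ / 4 * ‖v‖ ^ 2 ≤ ‖U 0 v‖ ^ 2) (t : ℕ) :
    ‖L - U t ∘L (U t).adjoint‖ ≤ 100 * l ^ 2 / (η * Δ ^ 2) * (1 - η * Δ / 4) ^ t := by
  have hη := h.η_pos
  have hΔ := h.Δ_pos
  have hl := h.l_pos
  have hm := h.Δ_le
  have hml := h.m_le
  have he : η * Δ ≤ 1 / 36 := by nlinarith [h.lin]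
  have he0 : 0 < η * Δ := by positivity
  have hU : ∀ t, ‖U t‖ ^ 2 ≤ 2 * l := fun t => by
    have : ‖U t‖ ≤ √(2 * l) := by
      refine ContinuousLinearMap.opNorm_le_bound _ (by positivity) fun v => ?_
      apply le_of_sq_le_sq _ (by positivity)
      rw [mul_pow, Real.sq_sqrt (by positivity)]
      have h1 := real_inner_le_norm (((U t).adjoint ∘L U t + (J t).adjoint ∘L J t) v) v
      have h2 := ContinuousLinearMap.le_of_opNorm_le _ (hX t) v
      have h3 := mul_le_mul_of_nonneg_right h2 (norm_nonneg v)
      rw [_root_.add_apply, inner_add_left, ContinuousLinearMap.comp_apply,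
        ContinuousLinearMap.comp_apply, ContinuousLinearMap.adjoint_inner_left,
        ContinuousLinearMap.adjoint_inner_left, real_inner_self_eq_norm_sq,
        real_inner_self_eq_norm_sq] at h1
      have := sq_nonneg ‖J t v‖
      rw [_root_.add_apply, ContinuousLinearMap.comp_apply,
        ContinuousLinearMap.comp_apply] at h3
      linarith
    calc _ ≤ √(2 * l) ^ 2 := by gcongr
      _ = _ := Real.sq_sqrt (by positivity)
  have hJ : ∀ t, ‖J t‖ ^ 2 ≤ m - Δ / 2 := fun t => by
    induction t with
    | zero => exact hJ0
    | succ t ih => rw [hJt]; exact norm_sq_botStep_le h hS (hU t) ih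
  have hlow : ∀ t u, Δ / 4 * ‖u‖ ^ 2 ≤ ‖(U t).adjoint u‖ ^ 2 := fun t => by
    induction t with
    | zero => exact le_norm_sq_adjoint hdim (by positivity) hU0
    | succ t ih => rw [hUt]; exact le_norm_sq_adjoint_topStep h hL hLs hLm (hU t) (hJ t) ih
  have hlow' : ∀ t v, Δ / 4 * ‖v‖ ^ 2 ≤ ‖U t v‖ ^ 2 := fun t v => by
    have := le_norm_sq_adjoint hdim.symm (by positivity) (hlow t) v
    rwa [ContinuousLinearMap.adjoint_adjoint] at this
  set s := 1 - η * Δ / 2 with hs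
  have hs0 : 0 ≤ s := by linarith
  have hratio : ∀ t v, ‖J t v‖ ≤ 2 * l / Δ * s ^ t * ‖U t v‖ := fun t => by
    induction t with
    | zero =>
      intro v
      apply le_of_sq_le_sq _ (by positivity)
      have h1 := norm_sq_le_of_norm_sq_le hJ0 v
      have h2 : m * Δ ≤ l ^ 2 := by nlinarith
      calc ‖J 0 v‖ ^ 2 ≤ m * ‖v‖ ^ 2 := h1.trans (by gcongr; linarith)
        _ = (m * Δ) / Δ ^ 2 * 4 * (Δ / 4 * ‖v‖ ^ 2) := by field_simp
        _ ≤ l ^ 2 / Δ ^ 2 * 4 * ‖U 0 v‖ ^ 2 := by gcongr; exact hU0 v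
        _ = _ := by ring
    | succ t ih =>
      intro v
      rw [hJt, hUt, pow_succ, ← mul_assoc]
      exact norm_botStep_le_norm_topStep h hL hLm hS (hU t) (hX t) (hlow' t) (by positivity) ih v
  set b := 96 * l ^ 4 / Δ ^ 3 with hb
  have hb0 : 0 ≤ b := by positivity
  have hres : ∀ t, ‖L - U t ∘L (U t).adjoint‖ ≤
      (2 * l + b) * (1 - η * Δ / 4) ^ t - b * (s ^ 2) ^ t := fun t => by
    induction t with
    | zero =>
      have := norm_sub_comp_adjoint_le hl hL hLs
        (fun x => le_trans (by have := hΔ.trans_le hm; positivity) (hLm x)) (hU 0)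
      simpa using this
    | succ t ih =>
      have hn : ‖J t ∘L (U t).adjoint‖ ≤ 2 * l / Δ * s ^ t * (2 * l) := by
        refine ContinuousLinearMap.opNorm_le_bound _ (by positivity) fun u => ?_
        rw [ContinuousLinearMap.comp_apply, mul_assoc]
        refine (hratio t _).trans ?_
        gcongr
        calc _ ≤ ‖U t‖ * (‖U t‖ * ‖u‖) :=
              (ContinuousLinearMap.le_opNorm _ _).trans (by
                gcongr
                exact (ContinuousLinearMap.le_opNorm _ _).trans_eq (by
                  rw [LinearIsometryEquiv.norm_map]))
          _ = ‖U t‖ ^ 2 * ‖u‖ := by ring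
          _ ≤ _ := by gcongr; exact hU t
      refine (norm_residual_topStep_le h hL hLs hLm (hU t) (hJ t) (hlow t) ih hn (hUt t)).trans ?_
      have e1 : 3 * η * (2 * l / Δ * s ^ t * (2 * l)) ^ 2 = b * (η * Δ / 2) * (s ^ 2) ^ t := by
        rw [mul_pow, mul_pow, ← pow_mul, mul_comm t 2, pow_mul, hb]
        field_simp
        norm_num
        exact mul_comm _ _
      have e2 : s ^ 2 + η * Δ / 2 ≤ 1 - η * Δ / 4 := by rw [hs]; nlinarith
      have e3 := mul_le_mul_of_nonneg_left e2 (by positivity : 0 ≤ b * (s ^ 2) ^ t)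
      rw [e1, pow_succ (s ^ 2) t, pow_succ _ t]
      linarith
  refine (hres t).trans ?_
  have hq : 0 ≤ 1 - η * Δ / 4 := by linarith
  have hK : 2 * l + b ≤ 100 * l ^ 2 / (η * Δ ^ 2) := by
    rw [le_div_iff₀ (by positivity)]
    have e1 : b * (η * Δ ^ 2) = 96 * l * (η * l ^ 3) / Δ := by rw [hb]; field_simp
    have e2 : 96 * l * (η * l ^ 3) / Δ ≤ 96 * l * (Δ ^ 2 / 36) / Δ := by
      gcongr; linarith [h.cube]
    have e3 : 96 * l * (Δ ^ 2 / 36) / Δ = 96 / 36 * (l * Δ) := by field_simp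
    have e4 : l * Δ ≤ l * l := by gcongr; linarith
    have e5 : η * Δ * (l * Δ) ≤ 1 / 36 * (l * Δ) := by gcongr
    nlinarith
  have h1 : 0 ≤ b * (s ^ 2) ^ t := by positivity
  have h2 := mul_le_mul_of_nonneg_right hK (pow_nonneg hq t)
  linarith

end Op

section MatrixOp
open scoped InnerProductSpace

/-- The operator between Euclidean spaces given by a matrix. -/
noncomputable def euclideanOp {m n : ℕ} (M : Matrix (Fin m) (Fin n) ℝ) :
    EuclideanSpace ℝ (Fin n) →L[ℝ] EuclideanSpace ℝ (Fin m) :=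
  LinearMap.toContinuousLinearMap (Matrix.toLpLin 2 2 M)

variable {m n k : ℕ}

theorem euclideanOp_apply (M : Matrix (Fin m) (Fin n) ℝ) (v : EuclideanSpace ℝ (Fin n)) :
    euclideanOp M v = WithLp.toLp 2 (M *ᵥ v.ofLp) := rfl

theorem euclideanOp_add (M N : Matrix (Fin m) (Fin n) ℝ) :
    euclideanOp (M + N) = euclideanOp M + euclideanOp N := by
  simp [euclideanOp]

theorem euclideanOp_sub (M N : Matrix (Fin m) (Fin n) ℝ) :
    euclideanOp (M - N) = euclideanOp M - euclideanOp N := by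
  simp [euclideanOp]

theorem euclideanOp_smul (c : ℝ) (M : Matrix (Fin m) (Fin n) ℝ) :
    euclideanOp (c • M) = c • euclideanOp M := by
  simp [euclideanOp]

theorem euclideanOp_mul (M : Matrix (Fin m) (Fin n) ℝ) (N : Matrix (Fin n) (Fin k) ℝ) :
    euclideanOp (M * N) = euclideanOp M ∘L euclideanOp N := by
  ext v : 1
  simp [euclideanOp_apply]

theorem euclideanOp_transpose (M : Matrix (Fin m) (Fin n) ℝ) :
    euclideanOp Mᵀ = (euclideanOp M).adjoint := by
  rw [euclideanOp, euclideanOp, ← LinearMap.adjoint_toContinuousLinearMap,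
    ← Matrix.conjTranspose_eq_transpose_of_trivial]
  congr 1
  exact Matrix.toEuclideanLin_conjTranspose_eq_adjoint M

theorem norm_euclideanOp_diagonal_le {f : Fin n → ℝ} {c : ℝ} (hc : 0 ≤ c) (h0 : ∀ i, 0 ≤ f i)
    (h : ∀ i, f i ≤ c) : ‖euclideanOp (Matrix.diagonal f)‖ ≤ c := by
  refine ContinuousLinearMap.opNorm_le_bound _ hc fun v => ?_
  apply le_of_sq_le_sq _ (by positivity)
  rw [mul_pow, EuclideanSpace.real_norm_sq_eq, EuclideanSpace.real_norm_sq_eq, Finset.mul_sum]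
  refine Finset.sum_le_sum fun i _ => ?_
  rw [euclideanOp_apply]
  simp only [Matrix.mulVec_diagonal, mul_pow]
  have := h0 i
  have := h i
  gcongr

theorem le_inner_euclideanOp_diagonal {f : Fin n → ℝ} {c : ℝ} (h : ∀ i, c ≤ f i)
    (v : EuclideanSpace ℝ (Fin n)) :
    c * ‖v‖ ^ 2 ≤ ⟪euclideanOp (Matrix.diagonal f) v, v⟫_ℝ := by
  rw [EuclideanSpace.real_norm_sq_eq, PiLp.inner_apply, Finset.mul_sum]
  refine Finset.sum_le_sum fun i _ => ?_
  rw [euclideanOp_apply]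
  simp only [Matrix.mulVec_diagonal, RCLike.inner_apply, conj_trivial]
  nlinarith [mul_le_mul_of_nonneg_right (h i) (sq_nonneg (v i))]

theorem sigmaMax_le {M : Matrix (Fin m) (Fin n) ℝ} {c : ℝ} (hc : 0 ≤ c)
    (h : ‖euclideanOp M‖ ≤ c) : sigmaMax M ≤ c := by
  refine Real.sSup_le ?_ hc
  rintro _ ⟨v, hv, rfl⟩
  have := (euclideanOp M).le_of_opNorm_le h v
  rwa [hv, mul_one] at this

theorem norm_euclideanOp_le_sigmaMax (M : Matrix (Fin m) (Fin n) ℝ) :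
    ‖euclideanOp M‖ ≤ sigmaMax M := by
  have hbdd : BddAbove {c : ℝ | ∃ v : EuclideanSpace ℝ (Fin n), ‖v‖ = 1 ∧
      c = ‖(EuclideanSpace.equiv (Fin m) ℝ).symm
        (M.mulVec ((EuclideanSpace.equiv (Fin n) ℝ) v))‖} := by
    refine ⟨‖euclideanOp M‖, ?_⟩
    rintro _ ⟨v, hv, rfl⟩
    have := (euclideanOp M).le_opNorm v
    rwa [hv, mul_one] at this
  have h0 : 0 ≤ sigmaMax M := Real.sSup_nonneg (by rintro _ ⟨v, -, rfl⟩; exact norm_nonneg _)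
  refine ContinuousLinearMap.opNorm_le_of_unit_norm h0 fun v hv => ?_
  exact le_csSup hbdd ⟨v, hv, rfl⟩

theorem sigmaMin_sq_mul_norm_sq_le (M : Matrix (Fin m) (Fin n) ℝ)
    (v : EuclideanSpace ℝ (Fin n)) : sigmaMin M ^ 2 * ‖v‖ ^ 2 ≤ ‖euclideanOp M v‖ ^ 2 := by
  have h0 : 0 ≤ sigmaMin M := Real.sInf_nonneg (by rintro _ ⟨v, -, rfl⟩; exact norm_nonneg _)
  rw [← mul_pow]
  gcongr
  rcases eq_or_ne v 0 with rfl | hv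
  · simp
  have hv' : 0 < ‖v‖ := norm_pos_iff.2 hv
  have h1 : sigmaMin M ≤ ‖euclideanOp M (‖v‖⁻¹ • v)‖ := by
    refine csInf_le ⟨0, ?_⟩ ⟨‖v‖⁻¹ • v, norm_smul_inv_norm (𝕜 := ℝ) hv, rfl⟩
    rintro _ ⟨v, -, rfl⟩
    exact norm_nonneg _
  rw [map_smul, norm_smul, norm_inv, norm_norm, inv_mul_eq_div] at h1
  exact (le_div_iff₀ hv').1 h1

end MatrixOp

section Blocks
variable {d r : ℕ}

theorem Fin.sum_eq_sum_castLE_add_sum {α : Type*} [AddCommMonoid α] (h : r ≤ d) (f : Fin d → α) :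
    ∑ i, f i = ∑ i : Fin r, f (Fin.castLE h i) +
      ∑ i : Fin (d - r), f ⟨r + i, by have := i.isLt; omega⟩ := by
  have key : ∀ k (hk : d = r + k), ∑ i, f i = ∑ i : Fin r, f (Fin.castLE h i) +
      ∑ i : Fin k, f ⟨r + i, by have := i.isLt; omega⟩ := by
    rintro k rfl
    exact Fin.sum_univ_add f
  exact key _ (by omega)

theorem transpose_mul_self_eq_blocks (h : r ≤ d) (X : Matrix (Fin d) (Fin r) ℝ) :
    Xᵀ * X = (topBlock h X)ᵀ * topBlock h X + (botBlock X)ᵀ * botBlock X := by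
  ext i j
  simp only [Matrix.mul_apply, Matrix.add_apply, Matrix.transpose_apply]
  exact Fin.sum_eq_sum_castLE_add_sum h _

theorem topBlock_gradStep (h : r ≤ d) (f : Fin d → ℝ) (η : ℝ) (X : Matrix (Fin d) (Fin r) ℝ) :
    topBlock h (X + η • ((Matrix.diagonal f - X * Xᵀ) * X)) =
      topBlock h X + η • (Matrix.diagonal (fun i => f (Fin.castLE h i)) * topBlock h X -
        topBlock h X * ((topBlock h X)ᵀ * topBlock h X + (botBlock X)ᵀ * botBlock X)) := by
  rw [← transpose_mul_self_eq_blocks h X, Matrix.sub_mul, Matrix.mul_assoc X]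
  ext i j
  simp [topBlock, Matrix.diagonal_mul]
  exact Or.inl rfl

theorem botBlock_gradStep (h : r ≤ d) (f : Fin d → ℝ) (η : ℝ) (X : Matrix (Fin d) (Fin r) ℝ) :
    botBlock (X + η • ((Matrix.diagonal f - X * Xᵀ) * X)) =
      botBlock X + η • (Matrix.diagonal
        (fun i : Fin (d - r) => f ⟨r + i, by have := i.isLt; omega⟩) * botBlock X -
        botBlock X * ((topBlock h X)ᵀ * topBlock h X + (botBlock X)ᵀ * botBlock X)) := by
  rw [← transpose_mul_self_eq_blocks h X, Matrix.sub_mul, Matrix.mul_assoc X]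
  ext i j
  simp [botBlock, Matrix.diagonal_mul]
  exact Or.inl rfl

end Blocks

/-- Lemma 2.4: linear convergence of `P_t = Λ_r − U_t U_tᵀ` to zero. -/
theorem P_linear_convergence (d r : ℕ) (hr : 0 < r) (hrd : r < d)
    (lam : Fin d → ℝ)
    (hmono : ∀ i j : Fin d, i ≤ j → lam j ≤ lam i)
    (hnn : ∀ i, 0 ≤ lam i)
    (η : ℝ) (hη : 0 < η)
    (hΔ : 0 < lam ⟨r - 1, by omega⟩ - lam ⟨r, hrd⟩)
    (hηle : η ≤ (lam ⟨r - 1, by omega⟩ - lam ⟨r, hrd⟩) ^ 2 / (36 * lam ⟨0, by omega⟩ ^ 3))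
    (X0 : Matrix (Fin d) (Fin r) ℝ)
    (hX0 : inR hrd.le (lam ⟨0, by omega⟩) (lam ⟨r - 1, by omega⟩)
      (lam ⟨r - 1, by omega⟩ - lam ⟨r, hrd⟩) X0) :
    ∀ t : ℕ,
      sigmaMax
          (Matrix.diagonal (fun i : Fin r => lam (Fin.castLE hrd.le i)) -
            topBlock hrd.le (gdIter (Matrix.diagonal lam) η X0 (t + 1)) *
              (topBlock hrd.le (gdIter (Matrix.diagonal lam) η X0 (t + 1)))ᵀ) ≤
        (100 * lam ⟨0, by omega⟩ ^ 2 /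
            (η * (lam ⟨r - 1, by omega⟩ - lam ⟨r, hrd⟩) ^ 2)) *
          (1 - η * (lam ⟨r - 1, by omega⟩ - lam ⟨r, hrd⟩) / 4) ^ (t + 1) := by
  have hη0 := hη.le
  set l := lam ⟨0, by omega⟩ with hl
  set m := lam ⟨r - 1, by omega⟩ with hm
  set Δ := m - lam ⟨r, hrd⟩ with hΔdef
  have hml : m ≤ l := hmono _ _ (Fin.mk_le_mk.2 (Nat.zero_le _))
  have hΔm : Δ ≤ m := by linarith [hnn ⟨r, hrd⟩]
  have hl0 : 0 < l := by linarith
  have h : StepBounds η l m Δ := by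
    refine ⟨hη, hΔ, hΔm, hml, ?_⟩
    rw [le_div_iff₀ (by positivity)] at hηle
    linarith
  have hle : ∀ i, lam i ≤ l := fun i => hmono _ _ (Fin.mk_le_mk.2 (Nat.zero_le _))
  obtain ⟨h1, h2, h3⟩ := hX0
  set X := gdIter (Matrix.diagonal lam) η X0 with hX
  have hstep : ∀ t, X (t + 1) = X t + η • ((Matrix.diagonal lam - X t * (X t)ᵀ) * X t) :=
    fun t => rfl
  have hXn : ∀ t, ‖euclideanOp (X t)‖ ^ 2 ≤ 2 * l := fun t => by
    induction t with
    | zero => exact le_trans (by gcongr; exact norm_euclideanOp_le_sigmaMax _) h1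
    | succ t ih =>
      have := norm_sq_gradStep_le (norm_euclideanOp_diagonal_le hl0.le hnn hle) hη0
        (by linarith [h.lin]) ih
      rwa [← euclideanOp_transpose, ← euclideanOp_mul, ← euclideanOp_mul, ← euclideanOp_mul,
        ← euclideanOp_sub, ← euclideanOp_smul, ← euclideanOp_add, ← Matrix.mul_assoc,
        ← Matrix.sub_mul, ← hstep] at this
  intro t
  have hq : 0 ≤ 1 - η * Δ / 4 := by nlinarith [h.lin]
  refine sigmaMax_le (by positivity) ?_
  rw [euclideanOp_sub, euclideanOp_mul, euclideanOp_transpose]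
  refine norm_residual_le rfl h (U := fun t => euclideanOp (topBlock hrd.le (X t)))
    (J := fun t => euclideanOp (botBlock (X t)))
    (S := euclideanOp (Matrix.diagonal
      (fun i : Fin (d - r) => lam ⟨r + i, by have := i.isLt; omega⟩)))
    (norm_euclideanOp_diagonal_le hl0.le (fun _ => hnn _) fun _ => hle _) ?_
    (le_inner_euclideanOp_diagonal fun i => hmono _ _ ?_)
    (norm_euclideanOp_diagonal_le (by linarith [hnn ⟨r, hrd⟩]) (fun _ => hnn _) fun i => ?_)
    (fun t => ?_) (fun t => ?_) (fun t => ?_) ?_ (fun v => ?_) (t + 1)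
  · rw [← euclideanOp_transpose, Matrix.diagonal_transpose]
  · have := i.isLt
    simp only [Fin.le_def, Fin.val_castLE]
    omega
  · rw [hΔdef, sub_sub_cancel]
    exact hmono _ _ (by simp [Fin.le_def])
  · simp only [hstep, topBlock_gradStep, euclideanOp_add, euclideanOp_smul, euclideanOp_sub,
      euclideanOp_mul, euclideanOp_transpose]
  · simp only [hstep, botBlock_gradStep hrd.le, euclideanOp_add, euclideanOp_smul,
      euclideanOp_sub, euclideanOp_mul, euclideanOp_transpose]
  · simp only [← euclideanOp_transpose, ← euclideanOp_mul, ← euclideanOp_add,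
      ← transpose_mul_self_eq_blocks hrd.le]
    rw [euclideanOp_mul, euclideanOp_transpose]
    refine (ContinuousLinearMap.opNorm_comp_le _ _).trans ?_
    rw [LinearIsometryEquiv.norm_map, ← sq]
    exact hXn t
  · exact le_trans (by gcongr; exact norm_euclideanOp_le_sigmaMax _) h2
  · exact le_trans (by gcongr; exact h3) (sigmaMin_sq_mul_norm_sq_le _ v)
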